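/- Let Γ be a finitely generated group and let μ be an admissible probability measure on Γ whose random walk is transient at the spectral radius. Then ω_Γ(1) = 0, i.e. limsup_{n→∞} (1/n) log ( Σ_{x∈S_n} G(e,x) ) = 0. -/

import Mathlib

open scoped Pointwise Classical
open Filter

namespace GreenGrowth

variable {G : Type*} [Group G]

/-- Word length with respect to a finite generating set `S` (symmetrized). -/
noncomputable def wordLength (S : Finset G) (x : G) : ℕ :=
  sInf {n : ℕ | x ∈ ((S : Set G) ∪ (S : Set G)⁻¹) ^ n}

/-- `n`-step distribution of the `μ`-random walk: the `n`-fold convolution power of `μ`,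
so that `p_n(x, y) = convPow μ n (x⁻¹ * y)`. -/
noncomputable def convPow (μ : G → ℝ) : ℕ → G → ℝ
  | 0 => fun x => if x = 1 then 1 else 0
  | n + 1 => fun x => ∑' y : G, μ y * convPow μ n (y⁻¹ * x)

/-- The Green function `G(e, x | r)`. -/
noncomputable def green (μ : G → ℝ) (r : ℝ) (x : G) : ℝ :=
  ∑' n : ℕ, r ^ n * convPow μ n x

/-- `μ` is a probability measure on `G`. -/
def IsProbMeasure (μ : G → ℝ) : Prop := (∀ x, 0 ≤ μ x) ∧ HasSum μ 1

/-- `μ` is admissible: its support generates `G` as a semigroup, i.e. every element of `G`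
is reached with positive probability at some time. -/
def IsAdmissible (μ : G → ℝ) : Prop := ∀ x : G, ∃ n : ℕ, 0 < convPow μ n x

/-- `μ` is symmetric. -/
def IsSymm (μ : G → ℝ) : Prop := ∀ x : G, μ x⁻¹ = μ x

/-- The spectral radius of the `μ`-random walk. -/
noncomputable def spectralRadius (μ : G → ℝ) : ℝ :=
  limsup (fun n : ℕ => (convPow μ n 1) ^ ((n : ℝ)⁻¹)) atTop

/-- `R`, the radius of convergence of the Green function: the inverse of the
spectral radius. -/
noncomputable def greenRadius (μ : G → ℝ) : ℝ := (spectralRadius μ)⁻¹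

/-- The `μ`-random walk is transient at the spectral radius: the Green function
`G(x, y | r)` is finite for all `x, y` and all `0 < r ≤ R`. -/
def TransientAtSpectralRadius (μ : G → ℝ) : Prop :=
  ∀ r : ℝ, 0 < r → r ≤ greenRadius μ →
    ∀ x : G, Summable (fun n : ℕ => r ^ n * convPow μ n x)

/-- `H_r(n) = Σ_{x ∈ S_n} G(e, x | r)`, the sum of the Green function over the sphere
of radius `n`. -/
noncomputable def greenSphereSum (S : Finset G) (μ : G → ℝ) (r : ℝ) (n : ℕ) : ℝ :=
  ∑' x : G, if wordLength S x = n then green μ r x else 0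

/-- `ω_Γ(r) = limsup (1/n) log H_r(n)`, the growth rate of the Green function. -/
noncomputable def greenGrowthRate (S : Finset G) (μ : G → ℝ) (r : ℝ) : ℝ :=
  limsup (fun n : ℕ => Real.log (greenSphereSum S μ r n) / n) atTop

/-- The cardinality of the sphere of radius `n`. -/
noncomputable def sphereCard (S : Finset G) (n : ℕ) : ℕ :=
  Nat.card {x : G // wordLength S x = n}

/-- The volume growth rate `v = limsup (1/n) log #S_n`. -/
noncomputable def volumeGrowthRate (S : Finset G) : ℝ :=
  limsup (fun n : ℕ => Real.log (sphereCard S n) / n) atTop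

end GreenGrowth


namespace GreenGrowth

lemma summable_mul_of_bounded {G : Type*} {μ : G → ℝ} (hμ : IsProbMeasure μ)
    {f : G → ℝ} {c : ℝ} (hf : ∀ y, |f y| ≤ c) : Summable fun y => μ y * f y := by
  refine Summable.of_norm_bounded (hμ.2.summable.mul_right c) fun y => ?_
  rw [norm_mul, Real.norm_of_nonneg (hμ.1 y), Real.norm_eq_abs]
  exact mul_le_mul_of_nonneg_left (hf y) (hμ.1 y)

section ConvolutionPowers

variable {G : Type*} [Group G] {μ : G → ℝ}

lemma convPow_nonneg (hμ : IsProbMeasure μ) (n : ℕ) (x : G) : 0 ≤ convPow μ n x := by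
  induction n generalizing x with
  | zero => simp only [convPow]; split_ifs <;> norm_num
  | succ n ih => exact tsum_nonneg fun y => mul_nonneg (hμ.1 y) (ih _)

lemma hasSum_convPow (hμ : IsProbMeasure μ) (n : ℕ) : HasSum (convPow μ n) 1 := by
  induction n with
  | zero => exact hasSum_ite_eq (1 : G) (1 : ℝ)
  | succ n ih =>
    have hprod : HasSum (fun q : G × G => μ q.1 * convPow μ n q.2) 1 := by
      simpa using hμ.2.mul ih
        (hμ.2.summable.mul_of_nonneg ih.summable hμ.1 (convPow_nonneg hμ n))
    let e : G × G ≃ G × G :=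
      { toFun := fun q => (q.2, q.2⁻¹ * q.1)
        invFun := fun q => (q.1 * q.2, q.1)
        left_inv := fun q => by simp
        right_inv := fun q => by simp }
    have h := e.hasSum_iff.2 hprod
    refine h.prod_fiberwise fun x => ?_
    exact (h.summable.prod_factor x).hasSum

lemma convPow_le_one (hμ : IsProbMeasure μ) (n : ℕ) (x : G) : convPow μ n x ≤ 1 :=
  le_hasSum (hasSum_convPow hμ n) x fun y _ => convPow_nonneg hμ n y

lemma hasSum_convPow_succ (hμ : IsProbMeasure μ) (n : ℕ) (x : G) :
    HasSum (fun y => μ y * convPow μ n (y⁻¹ * x)) (convPow μ (n + 1) x) :=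
  (summable_mul_of_bounded hμ (c := 1) fun y => by
    rw [abs_of_nonneg (convPow_nonneg hμ _ _)]; exact convPow_le_one hμ _ _).hasSum

lemma convPow_mul_le (hμ : IsProbMeasure μ) (n m : ℕ) (x y : G) :
    convPow μ n x * convPow μ m y ≤ convPow μ (n + m) (x * y) := by
  induction n generalizing x with
  | zero =>
    by_cases hx : x = 1
    · simp [convPow, hx]
    · simpa [convPow, hx] using convPow_nonneg hμ m (x * y)
  | succ n ih =>
    rw [show n + 1 + m = n + m + 1 by ring]
    refine hasSum_le (fun z => ?_) ((hasSum_convPow_succ hμ n x).mul_right (convPow μ m y))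
      (hasSum_convPow_succ hμ (n + m) (x * y))
    rw [mul_assoc, ← mul_assoc z⁻¹]
    exact mul_le_mul_of_nonneg_left (ih _) (hμ.1 z)

lemma convPow_one_pow_le (hμ : IsProbMeasure μ) (d k : ℕ) :
    convPow μ d 1 ^ k ≤ convPow μ (k * d) 1 := by
  induction k with
  | zero => simp [convPow]
  | succ k ih =>
    calc convPow μ d 1 ^ (k + 1) = convPow μ d 1 ^ k * convPow μ d 1 := pow_succ _ _
      _ ≤ convPow μ (k * d) 1 * convPow μ d 1 :=
        mul_le_mul_of_nonneg_right ih (convPow_nonneg hμ _ _)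
      _ ≤ convPow μ ((k + 1) * d) 1 := by
        simpa [add_mul] using convPow_mul_le hμ (k * d) d 1 1

lemma exists_convPow_one_pos (hμ : IsProbMeasure μ) (hadm : IsAdmissible μ) :
    ∃ d : ℕ, 0 < d ∧ 0 < convPow μ d 1 := by
  obtain ⟨y, hy⟩ : ∃ y, 0 < μ y := by
    by_contra! h
    have h0 : μ = 0 := funext fun y => le_antisymm (h y) (hμ.1 y)
    have := hμ.2
    rw [h0] at this
    exact zero_ne_one (hasSum_zero.unique this)
  obtain ⟨n, hn⟩ := hadm y⁻¹
  refine ⟨n + 1, n.succ_pos, (mul_pos hy hn).trans_le ?_⟩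
  simpa using le_hasSum (hasSum_convPow_succ hμ n 1) y
    fun z _ => mul_nonneg (hμ.1 z) (convPow_nonneg hμ n _)

lemma one_le_greenRadius (hμ : IsProbMeasure μ) (hadm : IsAdmissible μ) :
    1 ≤ greenRadius μ := by
  have hle : ∀ n : ℕ, convPow μ n 1 ^ ((n : ℝ)⁻¹) ≤ 1 := fun n =>
    Real.rpow_le_one (convPow_nonneg hμ _ _) (convPow_le_one hμ _ _) (by positivity)
  have hge : ∀ n : ℕ, 0 ≤ convPow μ n 1 ^ ((n : ℝ)⁻¹) := fun n =>
    Real.rpow_nonneg (convPow_nonneg hμ _ _) _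
  obtain ⟨d, hd, hpos⟩ := exists_convPow_one_pos hμ hadm
  have hlow : convPow μ d 1 ^ ((d : ℝ)⁻¹) ≤ spectralRadius μ := by
    refine le_limsup_of_frequently_le ?_ (isBoundedUnder_of ⟨1, hle⟩)
    refine frequently_atTop.2 fun N => ⟨(N + 1) * d, by nlinarith, ?_⟩
    have hd' : (d : ℝ) ≠ 0 := by positivity
    calc convPow μ d 1 ^ ((d : ℝ)⁻¹)
        = (convPow μ d 1 ^ (N + 1)) ^ ((((N + 1) * d : ℕ) : ℝ)⁻¹) := by
          rw [← Real.rpow_natCast, ← Real.rpow_mul hpos.le]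
          congr 1
          push_cast
          field_simp
      _ ≤ _ := Real.rpow_le_rpow (by positivity) (convPow_one_pow_le hμ d (N + 1))
          (by positivity)
  have hup : spectralRadius μ ≤ 1 :=
    limsup_le_of_le (isCoboundedUnder_le_of_le atTop hge) (Eventually.of_forall hle)
  exact (one_le_inv₀ ((Real.rpow_pos_of_pos hpos _).trans_le hlow)).2 hup

/-- Maximum principle: the truncated Green function is maximal at the identity. -/
lemma sum_convPow_le_one (hμ : IsProbMeasure μ) (N : ℕ) (x : G) :
    ∑ k ∈ Finset.range N, convPow μ k x ≤ ∑ k ∈ Finset.range N, convPow μ k 1 := by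
  induction N generalizing x with
  | zero => simp
  | succ N ih =>
    by_cases hx : x = 1
    · rw [hx]
    have hstep : HasSum (fun y => μ y * ∑ k ∈ Finset.range N, convPow μ k (y⁻¹ * x))
        (∑ k ∈ Finset.range (N + 1), convPow μ k x) := by
      rw [Finset.sum_range_succ']
      simp only [Finset.mul_sum, show convPow μ 0 x = 0 by simp [convPow, hx], add_zero]
      exact hasSum_sum fun k _ => hasSum_convPow_succ hμ k x
    have hle := hasSum_le (fun y => mul_le_mul_of_nonneg_left (ih (y⁻¹ * x)) (hμ.1 y)) hstep
      (hμ.2.mul_right _)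
    rw [one_mul] at hle
    exact hle.trans (Finset.sum_le_sum_of_subset_of_nonneg
      (Finset.range_mono N.le_succ) fun k _ _ => convPow_nonneg hμ k 1)

lemma green_one_eq (x : G) : green μ 1 x = ∑' n, convPow μ n x := by simp [green]

lemma summable_convPow (hμ : IsProbMeasure μ) (hadm : IsAdmissible μ)
    (htrans : TransientAtSpectralRadius μ) (x : G) : Summable fun n => convPow μ n x := by
  simpa using htrans 1 one_pos (one_le_greenRadius hμ hadm) x

lemma green_one_nonneg (hμ : IsProbMeasure μ) (x : G) : 0 ≤ green μ 1 x := by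
  rw [green_one_eq]
  exact tsum_nonneg fun n => convPow_nonneg hμ n x

lemma green_one_le (hμ : IsProbMeasure μ) (hsum : ∀ x, Summable fun n => convPow μ n x) (x : G) :
    green μ 1 x ≤ green μ 1 1 := by
  rw [green_one_eq, green_one_eq]
  exact le_of_tendsto_of_tendsto' (hsum x).hasSum.tendsto_sum_nat
    (hsum 1).hasSum.tendsto_sum_nat fun N => sum_convPow_le_one hμ N x

/-- The expected total time of the walk is infinite. -/
lemma not_summable_green_one (hμ : IsProbMeasure μ)
    (hsum : ∀ x, Summable fun n => convPow μ n x) : ¬ Summable (green μ 1) := by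
  intro hG
  obtain ⟨N, hN⟩ := exists_nat_gt (∑' x, green μ 1 x)
  have h : HasSum (fun x => ∑ k ∈ Finset.range N, convPow μ k x) (N : ℝ) := by
    simpa using hasSum_sum (s := Finset.range N) fun k _ => hasSum_convPow hμ k
  refine hN.not_ge (hasSum_le (fun x => ?_) h hG.hasSum)
  rw [green_one_eq]
  exact (hsum x).sum_le_tsum _ fun k _ => convPow_nonneg hμ k x

end ConvolutionPowers

section Unitary

variable {G : Type*} [Group G] {μ : G → ℝ}
variable {E : Type*} [NormedAddCommGroup E] [InnerProductSpace ℝ E]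

open scoped InnerProductSpace

/-- The Markov operator `∑ μ(y) π(y)` of an isometric representation `π`. -/
noncomputable def markovOp (π : G →* (E →ₗᵢ[ℝ] E)) (μ : G → ℝ) : E →L[ℝ] E :=
  ∑' y, μ y • (π y).toContinuousLinearMap

/-- The Markov operator of the lazy walk. -/
noncomputable def lazyOp (π : G →* (E →ₗᵢ[ℝ] E)) (μ : G → ℝ) : E →L[ℝ] E :=
  (2 : ℝ)⁻¹ • (1 + markovOp π μ)

/-- The Dirichlet form `⟪f, (1 - P) f⟫` of the Markov operator `P`. -/
noncomputable def dirichletForm (π : G →* (E →ₗᵢ[ℝ] E)) (μ : G → ℝ) (f : E) : ℝ :=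
  ‖f‖ ^ 2 - ⟪f, markovOp π μ f⟫_ℝ

/-- The averaging operator of a finite set. -/
noncomputable def averageOp (π : G →* (E →ₗᵢ[ℝ] E)) (B : Finset G) : E →L[ℝ] E :=
  (B.card : ℝ)⁻¹ • ∑ y ∈ B, (π y).toContinuousLinearMap

variable {π : G →* (E →ₗᵢ[ℝ] E)}

lemma lazyOp_apply (f : E) : lazyOp π μ f = (2 : ℝ)⁻¹ • (f + markovOp π μ f) := rfl

lemma norm_sub_mul_le (f : E) (x y : G) :
    ‖f - π (x * y) f‖ ≤ ‖f - π x f‖ + ‖f - π y f‖ := by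
  rw [map_mul, ← (π x).norm_map (f - π y f), map_sub]
  exact norm_sub_le_norm_sub_add_norm_sub _ _ _

lemma averageOp_apply (B : Finset G) (f : E) :
    averageOp π B f = (B.card : ℝ)⁻¹ • ∑ y ∈ B, π y f := by
  simp [averageOp]

lemma norm_sub_le_of_mem_pow {T : Finset G} {f : E} {c : ℝ} (hT : ∀ x ∈ T, ‖f - π x f‖ ≤ c)
    (m : ℕ) (x : G) (hx : x ∈ T ^ m) : ‖f - π x f‖ ≤ m * c := by
  induction m generalizing x with
  | zero =>
    rw [pow_zero, Finset.mem_one] at hx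
    simp [hx]
  | succ m ih =>
    rw [pow_succ, Finset.mem_mul] at hx
    obtain ⟨y, hy, z, hz, rfl⟩ := hx
    push_cast
    linarith [norm_sub_mul_le (π := π) f y z, ih y hy, hT z hz]

lemma norm_sub_averageOp_le {B : Finset G} (hB : B.Nonempty) {f : E} {c : ℝ}
    (h : ∀ x ∈ B, ‖f - π x f‖ ≤ c) : ‖f - averageOp π B f‖ ≤ c := by
  have hB' : (0 : ℝ) < B.card := by exact_mod_cast hB.card_pos
  have : f - averageOp π B f = (B.card : ℝ)⁻¹ • ∑ y ∈ B, (f - π y f) := by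
    rw [averageOp_apply, Finset.sum_sub_distrib, smul_sub, Finset.sum_const,
      ← Nat.cast_smul_eq_nsmul ℝ, inv_smul_smul₀ hB'.ne']
  rw [this, norm_smul, norm_inv, Real.norm_of_nonneg hB'.le, inv_mul_le_iff₀ hB', ← nsmul_eq_mul]
  exact norm_sum_le_of_le _ h |>.trans_eq (Finset.sum_const c)

variable [CompleteSpace E]

lemma hasSum_markovOp_apply (π : G →* (E →ₗᵢ[ℝ] E)) (hμ : IsProbMeasure μ) (f : E) :
    HasSum (fun y => μ y • π y f) (markovOp π μ f) := by
  have h : Summable fun y => μ y • (π y).toContinuousLinearMap := by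
    refine Summable.of_norm_bounded hμ.2.summable fun y => ?_
    rw [norm_smul, Real.norm_of_nonneg (hμ.1 y)]
    exact mul_le_of_le_one_right (hμ.1 y) (LinearIsometry.norm_toContinuousLinearMap_le _)
  have h' := h.hasSum.mapL (ContinuousLinearMap.apply ℝ E f)
  simp only [ContinuousLinearMap.apply_apply, FunLike.coe_smul, Pi.smul_apply,
    LinearIsometry.coe_toContinuousLinearMap] at h'
  exact h'

lemma norm_map_markovOp_le {F : Type*} [NormedAddCommGroup F] [NormedSpace ℝ F]
    (hμ : IsProbMeasure μ) (T : E →L[ℝ] F) {c : ℝ} {f : E} (hf : ∀ g, ‖T (π g f)‖ ≤ c) (g : G) :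
    ‖T (π g (markovOp π μ f))‖ ≤ c := by
  have h := (hasSum_markovOp_apply π hμ f).mapL (T.comp (π g).toContinuousLinearMap)
  have hc : HasSum (fun y => μ y * c) c := by simpa using hμ.2.mul_right c
  refine h.norm_le_of_bounded hc fun y => ?_
  have := hf (g * y)
  rw [map_mul] at this
  simp only [map_smul, norm_smul, Real.norm_of_nonneg (hμ.1 y)]
  exact mul_le_mul_of_nonneg_left this (hμ.1 y)

lemma norm_map_lazyOp_pow_le {F : Type*} [NormedAddCommGroup F] [NormedSpace ℝ F]
    (hμ : IsProbMeasure μ) (T : E →L[ℝ] F) {c : ℝ} {f : E} (hf : ∀ g, ‖T (π g f)‖ ≤ c)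
    (k : ℕ) (g : G) : ‖T (π g ((lazyOp π μ ^ k) f))‖ ≤ c := by
  induction k generalizing g with
  | zero => simpa using hf g
  | succ k ih =>
    rw [pow_succ', mul_apply_eq_comp, lazyOp_apply]
    have h1 := norm_map_markovOp_le hμ T ih g
    have h2 := ih g
    simp only [map_smul, map_add, norm_smul, norm_inv, Real.norm_two]
    linarith [norm_add_le (T (π g ((lazyOp π μ ^ k) f)))
      (T (π g (markovOp π μ ((lazyOp π μ ^ k) f))))]

lemma norm_markovOp_apply_le (hμ : IsProbMeasure μ) (f : E) : ‖markovOp π μ f‖ ≤ ‖f‖ := by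
  simpa using norm_map_markovOp_le (π := π) (f := f) hμ (ContinuousLinearMap.id ℝ E)
    (fun g => ((π g).norm_map f).le) 1

lemma hasSum_dirichletForm (π : G →* (E →ₗᵢ[ℝ] E)) (hμ : IsProbMeasure μ) (f : E) :
    HasSum (fun y => μ y * (‖f - π y f‖ ^ 2 / 2)) (dirichletForm π μ f) := by
  have h1 := (hasSum_markovOp_apply π hμ f).mapL (innerSL ℝ f)
  have h2 := (hμ.2.mul_right (‖f‖ ^ 2)).sub h1
  simp only [innerSL_apply_apply, one_mul] at h2
  have heq : (fun y => μ y * (‖f - π y f‖ ^ 2 / 2)) =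
      fun y => μ y * ‖f‖ ^ 2 - ⟪f, μ y • π y f⟫_ℝ := by
    funext y
    rw [norm_sub_sq_real, (π y).norm_map, inner_smul_right]
    ring
  rw [heq]
  exact h2

lemma mul_norm_sub_sq_le_dirichletForm (hμ : IsProbMeasure μ) (f : E) (y : G) :
    μ y * (‖f - π y f‖ ^ 2 / 2) ≤ dirichletForm π μ f :=
  le_hasSum (hasSum_dirichletForm π hμ f) y fun z _ => mul_nonneg (hμ.1 z) (by positivity)

lemma dirichletForm_nonneg (hμ : IsProbMeasure μ) (f : E) : 0 ≤ dirichletForm π μ f :=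
  (hasSum_dirichletForm π hμ f).nonneg fun z => mul_nonneg (hμ.1 z) (by positivity)

lemma norm_lazyOp_apply_sq_le (hμ : IsProbMeasure μ) (f : E) :
    ‖lazyOp π μ f‖ ^ 2 ≤ ‖f‖ ^ 2 - dirichletForm π μ f / 2 := by
  have h := pow_le_pow_left₀ (norm_nonneg _) (norm_markovOp_apply_le (π := π) hμ f) 2
  rw [lazyOp_apply, norm_smul, mul_pow, norm_add_sq_real, dirichletForm]
  norm_num
  linarith

lemma exists_norm_sub_le_of_convPow_pos (π : G →* (E →ₗᵢ[ℝ] E)) (hμ : IsProbMeasure μ) (n : ℕ)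
    (x : G) (hx : 0 < convPow μ n x) :
    ∃ C : ℝ, 0 ≤ C ∧ ∀ f : E, ‖f - π x f‖ ≤ C * √(dirichletForm π μ f) := by
  induction n generalizing x with
  | zero =>
    have : x = 1 := by
      by_contra h
      simp [convPow, h] at hx
    exact ⟨0, le_rfl, fun f => by simp [this]⟩
  | succ n ih =>
    obtain ⟨y, hy⟩ : ∃ y, 0 < μ y * convPow μ n (y⁻¹ * x) := by
      by_contra! h
      exact hx.not_ge (tsum_nonpos h)
    have hy1 : 0 < μ y := pos_of_mul_pos_left hy (convPow_nonneg hμ n _)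
    obtain ⟨C, hC0, hC⟩ := ih _ (pos_of_mul_pos_right hy (hμ.1 y))
    refine ⟨√(2 / μ y) + C, by positivity, fun f => ?_⟩
    have h := norm_sub_mul_le (π := π) f y (y⁻¹ * x)
    rw [mul_inv_cancel_left] at h
    have h1 : ‖f - π y f‖ ≤ √(2 / μ y) * √(dirichletForm π μ f) := by
      rw [← Real.sqrt_mul (by positivity)]
      refine Real.le_sqrt_of_sq_le ?_
      have := mul_norm_sub_sq_le_dirichletForm (π := π) hμ f y
      rw [div_mul_eq_mul_div, le_div_iff₀ hy1]
      linarith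
    linarith [hC f]

lemma exists_norm_sub_le_of_mem_finset (π : G →* (E →ₗᵢ[ℝ] E)) (hμ : IsProbMeasure μ)
    (hadm : IsAdmissible μ) (T : Finset G) :
    ∃ C : ℝ, 0 < C ∧ ∀ x ∈ T, ∀ f : E, ‖f - π x f‖ ≤ C * √(dirichletForm π μ f) := by
  have h : ∀ x, ∃ C : ℝ, 0 ≤ C ∧ ∀ f : E, ‖f - π x f‖ ≤ C * √(dirichletForm π μ f) := fun x =>
    let ⟨n, hn⟩ := hadm x
    exists_norm_sub_le_of_convPow_pos π hμ n x hn
  choose C hC0 hC using h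
  have h0 : 0 ≤ ∑ x ∈ T, C x := Finset.sum_nonneg fun x _ => hC0 x
  refine ⟨1 + ∑ x ∈ T, C x, by linarith, fun x hx f => (hC x f).trans ?_⟩
  have := Finset.single_le_sum (fun y _ => hC0 y) hx
  exact mul_le_mul_of_nonneg_right (by linarith) (Real.sqrt_nonneg _)

end Unitary

/-- A nonincreasing sequence satisfying a Nash-type inequality at scale `V` becomes
smaller than `4 / V` after about `A * log V` steps. -/
lemma le_of_nash {u e : ℕ → ℝ} {A V : ℝ} (hA : 0 < A) (hV : 1 ≤ V) (hu0 : u 0 ≤ 1)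
    (he : ∀ k, 0 ≤ e k) (hstep : ∀ k, u (k + 1) ≤ u k - e k / 2)
    (hnash : ∀ k, u k ≤ A * e k + 2 / V) (k : ℕ) (hk : 4 * A * Real.log V ≤ k) :
    u k ≤ 4 / V := by
  have hVpos : 0 < V := by linarith
  have hanti : Antitone u := antitone_nat_of_succ_le fun j => by linarith [hstep j, he j]
  by_contra! hlt
  have hdecay : ∀ j ≤ k, u j ≤ Real.exp (-(j / (4 * A))) := by
    intro j hj
    induction j with
    | zero => simpa using hu0
    | succ j ih =>
      have h1 := ih (by omega)
      have h2 : 4 / V < u j := hlt.trans_le (hanti (by omega))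
      have h3 : u j ≤ 2 * A * e j := by
        have := hnash j
        have h4 : 2 / V = 4 / V / 2 := by ring
        linarith
      have h5 : u (j + 1) ≤ (1 - 1 / (4 * A)) * u j := by
        have : 1 / (4 * A) * u j ≤ e j / 2 := by
          rw [one_div, inv_mul_le_iff₀ (by positivity)]
          linarith
        linarith [hstep j]
      have h6 : 0 ≤ u j := (by positivity : 0 ≤ 4 / V).trans h2.le
      have h7 : 1 - 1 / (4 * A) ≤ Real.exp (-(1 / (4 * A))) := by
        linarith [Real.add_one_le_exp (-(1 / (4 * A)))]
      calc u (j + 1) ≤ Real.exp (-(1 / (4 * A))) * u j :=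
            h5.trans (mul_le_mul_of_nonneg_right h7 h6)
        _ ≤ Real.exp (-(1 / (4 * A))) * Real.exp (-(j / (4 * A))) := by gcongr
        _ = _ := by rw [← Real.exp_add]; push_cast; ring_nf
  have hfin : Real.exp (-(k / (4 * A))) ≤ V⁻¹ := by
    rw [← Real.exp_log hVpos, ← Real.exp_neg]
    gcongr
    rw [le_div_iff₀ (by positivity)]
    linarith
  have h8 : V⁻¹ ≤ 4 / V := by
    rw [inv_eq_one_div]; gcongr; norm_num
  linarith [hdecay k le_rfl]

lemma summable_rpow_of_le_exp {a : ℕ → ℝ} (ha : ∀ k, 0 ≤ a k) {A : ℕ} (hA : 0 < A) {L : ℝ}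
    (hL : 0 < L) (h : ∀ m k : ℕ, A * m ^ 3 ≤ k → a k ≤ 2 * Real.exp (-(L * m)))
    {θ : ℝ} (hθ : 0 < θ) : Summable fun k => a k ^ θ := by
  have hc : 0 < L * θ := by positivity
  have hsum : Summable fun k : ℕ =>
      2 ^ θ * (720 * Real.exp (L * θ) / (L * θ) ^ 6) * A ^ 2 * (1 / ((k + 1 : ℕ) : ℝ) ^ 2) :=
    ((summable_nat_add_iff 1).2 (Real.summable_one_div_nat_pow.2 one_lt_two)).mul_left _
  refine Summable.of_nonneg_of_le (fun k => Real.rpow_nonneg (ha k) _) (fun k => ?_) hsum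
  obtain ⟨m, hm1, hm2⟩ : ∃ m : ℕ, A * m ^ 3 ≤ k ∧ k < A * (m + 1) ^ 3 := by
    have hex : ∃ m : ℕ, k < A * (m + 1) ^ 3 := ⟨k,
      calc k < k + 1 := k.lt_succ_self
        _ ≤ (k + 1) ^ 3 := Nat.le_self_pow three_ne_zero _
        _ ≤ A * (k + 1) ^ 3 := Nat.le_mul_of_pos_left _ hA⟩
    refine ⟨Nat.find hex, ?_, Nat.find_spec hex⟩
    rcases Nat.eq_zero_or_pos (Nat.find hex) with h0 | h0
    · simp [h0]
    · have := Nat.find_min hex (Nat.sub_lt h0 one_pos)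
      rw [Nat.sub_add_cancel (Nat.one_le_of_lt h0)] at this
      exact not_lt.1 this
  have hk : ((k + 1 : ℕ) : ℝ) ^ 2 ≤ A ^ 2 * ((m : ℝ) + 1) ^ 6 := by
    have : ((k + 1 : ℕ) : ℝ) ≤ A * ((m : ℝ) + 1) ^ 3 := by exact_mod_cast hm2
    calc ((k + 1 : ℕ) : ℝ) ^ 2 ≤ (A * ((m : ℝ) + 1) ^ 3) ^ 2 := by gcongr
      _ = _ := by ring
  have hexp : ((m : ℝ) + 1) ^ 6 * Real.exp (-(L * m)) ^ θ ≤
      720 * Real.exp (L * θ) / (L * θ) ^ 6 := by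
    have h6 := Real.pow_div_factorial_le_exp (L * θ * (m + 1)) (by positivity) 6
    rw [show ((Nat.factorial 6 : ℕ) : ℝ) = 720 by norm_num [Nat.factorial],
      div_le_iff₀ (by norm_num), mul_pow] at h6
    rw [le_div_iff₀ (by positivity), ← Real.exp_mul]
    calc ((m : ℝ) + 1) ^ 6 * Real.exp (-(L * m) * θ) * (L * θ) ^ 6
        = ((L * θ) ^ 6 * ((m : ℝ) + 1) ^ 6) * Real.exp (-(L * m) * θ) := by ring
      _ ≤ (Real.exp (L * θ * (m + 1)) * 720) * Real.exp (-(L * m) * θ) := by gcongr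
      _ = 720 * (Real.exp (L * θ * (m + 1)) * Real.exp (-(L * m) * θ)) := by ring
      _ = 720 * Real.exp (L * θ) := by rw [← Real.exp_add]; ring_nf
  calc a k ^ θ ≤ (2 * Real.exp (-(L * m))) ^ θ := Real.rpow_le_rpow (ha k) (h m k hm1) hθ.le
    _ = 2 ^ θ * Real.exp (-(L * m)) ^ θ := Real.mul_rpow (by norm_num) (Real.exp_nonneg _)
    _ ≤ 2 ^ θ * (Real.exp (-(L * m)) ^ θ *
        (A ^ 2 * ((m : ℝ) + 1) ^ 6 / ((k + 1 : ℕ) : ℝ) ^ 2)) := by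
      gcongr
      exact le_mul_of_one_le_right (by positivity) ((one_le_div (by positivity)).2 hk)
    _ = 2 ^ θ * (((m : ℝ) + 1) ^ 6 * Real.exp (-(L * m)) ^ θ) * A ^ 2 *
        (1 / ((k + 1 : ℕ) : ℝ) ^ 2) := by ring
    _ ≤ _ := by gcongr

section Unitary

variable {G : Type*} [Group G] {μ : G → ℝ}
variable {E : Type*} [NormedAddCommGroup E] [InnerProductSpace ℝ E] [CompleteSpace E]

/-- Decay of the powers of the lazy Markov operator in terms of volume growth. -/
lemma exists_norm_lazyOp_pow_le (π : G →* (E →ₗᵢ[ℝ] E)) (hμ : IsProbMeasure μ)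
    (hadm : IsAdmissible μ) {T : Finset G} (hT : T.Nonempty) {f : E} (hf : ‖f‖ ≤ 1)
    (havg : ∀ (m : ℕ) (g : G),
      ‖averageOp π (T ^ m) (π g f)‖ ≤ (√((T ^ m).card : ℝ))⁻¹) :
    ∃ A : ℕ, 0 < A ∧ ∀ m k : ℕ, A * m ^ 3 ≤ k →
      ‖(lazyOp π μ ^ k) f‖ ^ 2 ≤ 4 / ((T ^ m).card : ℝ) := by
  obtain ⟨C, hC0, hC⟩ := exists_norm_sub_le_of_mem_finset π hμ hadm T
  obtain ⟨A, hA⟩ := exists_nat_ge (8 * C ^ 2 * Real.log T.card)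
  refine ⟨A + 1, A.succ_pos, fun m k hk => ?_⟩
  have hdecr : ∀ k, ‖(lazyOp π μ ^ (k + 1)) f‖ ^ 2 ≤
      ‖(lazyOp π μ ^ k) f‖ ^ 2 - dirichletForm π μ ((lazyOp π μ ^ k) f) / 2 := fun k => by
    rw [pow_succ' (lazyOp π μ), mul_apply_eq_comp]
    exact norm_lazyOp_apply_sq_le hμ _
  have h0 : ‖(lazyOp π μ ^ 0) f‖ ^ 2 ≤ 1 := by simpa using pow_le_one₀ (n := 2) (norm_nonneg f) hf
  have hV1 : (1 : ℝ) ≤ (T ^ m).card := by exact_mod_cast hT.pow.card_pos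
  have hm : 0 < m ∨ m = 0 := by omega
  rcases hm with hm | rfl
  · have hm' : (0 : ℝ) < m := by exact_mod_cast hm
    refine le_of_nash (e := fun k => dirichletForm π μ ((lazyOp π μ ^ k) f))
      (u := fun k => ‖(lazyOp π μ ^ k) f‖ ^ 2) (A := 2 * C ^ 2 * m ^ 2) (by positivity) hV1 h0
      (fun k => dirichletForm_nonneg hμ _) hdecr (fun k => ?_) k ?_
    · set F := (lazyOp π μ ^ k) f
      have h1 : ‖averageOp π (T ^ m) F‖ ≤ (√((T ^ m).card : ℝ))⁻¹ := by
        have := norm_map_lazyOp_pow_le hμ (averageOp π (T ^ m)) (havg m) k 1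
        rwa [map_one] at this
      have h2 : ‖F - averageOp π (T ^ m) F‖ ≤ m * (C * √(dirichletForm π μ F)) :=
        norm_sub_averageOp_le hT.pow (norm_sub_le_of_mem_pow (fun x hx => hC x hx F) m)
      have h3 : ‖F‖ ≤ m * (C * √(dirichletForm π μ F)) + (√((T ^ m).card : ℝ))⁻¹ := by
        have := norm_add_le (F - averageOp π (T ^ m) F) (averageOp π (T ^ m) F)
        rw [sub_add_cancel] at this
        linarith
      calc ‖F‖ ^ 2 ≤ (m * (C * √(dirichletForm π μ F)) + (√((T ^ m).card : ℝ))⁻¹) ^ 2 := by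
            gcongr
        _ ≤ 2 * ((m * (C * √(dirichletForm π μ F))) ^ 2 + ((√((T ^ m).card : ℝ))⁻¹) ^ 2) :=
            add_sq_le
        _ = _ := by
          rw [mul_pow, mul_pow, inv_pow, Real.sq_sqrt (dirichletForm_nonneg hμ F),
            Real.sq_sqrt (by positivity)]
          ring
    · have hlog : Real.log (T ^ m).card ≤ m * Real.log T.card := by
        rw [← Real.log_pow]
        exact Real.log_le_log (by positivity) (by exact_mod_cast Finset.card_pow_le)
      have hk' : ((A : ℝ) + 1) * m ^ 3 ≤ k := by exact_mod_cast hk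
      calc 4 * (2 * C ^ 2 * (m : ℝ) ^ 2) * Real.log (T ^ m).card
          ≤ 4 * (2 * C ^ 2 * (m : ℝ) ^ 2) * (m * Real.log T.card) := by gcongr
        _ = (8 * C ^ 2 * Real.log T.card) * m ^ 3 := by ring
        _ ≤ (A + 1) * m ^ 3 := by gcongr; linarith
        _ ≤ k := hk'
  · have hanti : Antitone fun k => ‖(lazyOp π μ ^ k) f‖ ^ 2 :=
      antitone_nat_of_succ_le fun j => by
        linarith [hdecr j, dirichletForm_nonneg (π := π) hμ ((lazyOp π μ ^ j) f)]
    have := (hanti k.zero_le).trans h0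
    simp only [pow_zero, Finset.card_one, Nat.cast_one, div_one]
    linarith

end Unitary

lemma norm_sum_single_one {G : Type*} (B : Finset G) :
    ‖∑ x ∈ B, lp.single (E := fun _ : G => ℝ) 2 x (1 : ℝ)‖ = √(B.card : ℝ) := by
  have h := lp.norm_sum_single (E := fun _ : G => ℝ) (p := 2) (by norm_num) (fun _ => 1) B
  norm_num at h
  rw [← h, Real.sqrt_sq (norm_nonneg _)]

section Regular

variable {G : Type*} [Group G] {μ : G → ℝ}

/-- The left regular representation on `ℓ²(G)`. -/
noncomputable def leftRegular (G : Type*) [Group G] :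
    G →* (lp (fun _ : G => ℝ) 2 →ₗᵢ[ℝ] lp (fun _ : G => ℝ) 2) where
  toFun g :=
    { toFun := fun f => ⟨fun x => f (g⁻¹ * x), by
        have h := lp.memℓp f
        rw [memℓp_gen_iff (by norm_num)] at h
        refine memℓp_gen ?_
        exact (Equiv.mulLeft g⁻¹).summable_iff.2 h⟩
      map_add' := fun f₁ f₂ => rfl
      map_smul' := fun c f => rfl
      norm_map' := fun f => by
        have h2 : 0 < (2 : ENNReal).toReal := by norm_num
        rw [lp.norm_eq_tsum_rpow h2, lp.norm_eq_tsum_rpow h2]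
        congr 1
        exact (Equiv.mulLeft g⁻¹).tsum_eq fun x => ‖f x‖ ^ (2 : ENNReal).toReal }
  map_one' := by
    ext f x
    change f (1⁻¹ * x) = f x
    simp
  map_mul' g h := by
    ext f x
    change f ((g * h)⁻¹ * x) = f (h⁻¹ * (g⁻¹ * x))
    simp [mul_assoc]

lemma leftRegular_apply (g : G) (f : lp (fun _ : G => ℝ) 2) (x : G) :
    leftRegular G g f x = f (g⁻¹ * x) := rfl

lemma leftRegular_single (g x : G) :
    leftRegular G g (lp.single 2 x (1 : ℝ)) = lp.single 2 (g * x) (1 : ℝ) := by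
  ext y
  rw [leftRegular_apply, lp.single_apply, lp.single_apply, Pi.single_apply, Pi.single_apply]
  simp only [inv_mul_eq_iff_eq_mul]

lemma norm_averageOp_leftRegular_single (B : Finset G) (hB : B.Nonempty) (x : G) :
    ‖averageOp (leftRegular G) B (lp.single 2 x (1 : ℝ))‖ = (√(B.card : ℝ))⁻¹ := by
  have hB' : (0 : ℝ) < B.card := by exact_mod_cast hB.card_pos
  have hsum : ∑ y ∈ B, leftRegular G y (lp.single 2 x (1 : ℝ)) =
      ∑ z ∈ B.map (Equiv.mulRight x).toEmbedding, lp.single 2 z (1 : ℝ) := by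
    simp [Finset.sum_map, leftRegular_single]
  rw [averageOp_apply, hsum, norm_smul, norm_sum_single_one, Finset.card_map, norm_inv,
    Real.norm_of_nonneg hB'.le]
  rw [inv_mul_eq_div, Real.sqrt_div_self]

lemma hasSum_markovOp_leftRegular (hμ : IsProbMeasure μ) (f : lp (fun _ : G => ℝ) 2) (x : G) :
    HasSum (fun y => μ y * f (y⁻¹ * x)) (markovOp (leftRegular G) μ f x) :=
  (hasSum_markovOp_apply (leftRegular G) hμ f).mapL (lp.evalCLM (𝕜 := ℝ) (fun _ : G => ℝ) 2 x)

lemma lazyOp_leftRegular_pow_nonneg (hμ : IsProbMeasure μ) (k : ℕ) (x : G) :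
    0 ≤ (lazyOp (leftRegular G) μ ^ k) (lp.single 2 1 (1 : ℝ)) x := by
  induction k generalizing x with
  | zero =>
    simp only [pow_zero, one_apply_eq_self, lp.single_apply, Pi.single_apply]
    split_ifs <;> norm_num
  | succ k ih =>
    rw [pow_succ', mul_apply_eq_comp, lazyOp_apply]
    have h := (hasSum_markovOp_leftRegular hμ ((lazyOp (leftRegular G) μ ^ k)
      (lp.single 2 1 (1 : ℝ))) x).nonneg fun y => mul_nonneg (hμ.1 y) (ih _)
    simp only [lp.coeFn_smul, lp.coeFn_add, Pi.smul_apply, Pi.add_apply, smul_eq_mul]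
    linarith [ih x]

/-- A nonnegative `g ∈ ℓ²(G)` with `P g = g - 2 δ` dominates twice the Green function. -/
lemma two_mul_sum_convPow_le (hμ : IsProbMeasure μ) {g : lp (fun _ : G => ℝ) 2}
    (hg0 : ∀ x, 0 ≤ g x)
    (hg : markovOp (leftRegular G) μ g = g - (2 : ℝ) • lp.single 2 1 (1 : ℝ)) (N : ℕ) (x : G) :
    2 * ∑ k ∈ Finset.range N, convPow μ k x ≤ g x := by
  induction N generalizing x with
  | zero => simpa using hg0 x
  | succ N ih =>
    have h1 : HasSum (fun y => μ y * (2 * ∑ k ∈ Finset.range N, convPow μ k (y⁻¹ * x)))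
        (2 * ∑ k ∈ Finset.range N, convPow μ (k + 1) x) := by
      have := (hasSum_sum (s := Finset.range N)
        fun k _ => hasSum_convPow_succ hμ k x).mul_left 2
      have heq : (fun y => μ y * (2 * ∑ k ∈ Finset.range N, convPow μ k (y⁻¹ * x))) =
          fun y => 2 * ∑ k ∈ Finset.range N, μ y * convPow μ k (y⁻¹ * x) := by
        funext y
        rw [← Finset.mul_sum]
        ring
      rwa [heq]
    have h2 := hasSum_le (fun y => mul_le_mul_of_nonneg_left (ih (y⁻¹ * x)) (hμ.1 y)) h1
      (hasSum_markovOp_leftRegular hμ g x)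
    rw [hg] at h2
    simp only [lp.coeFn_smul, lp.coeFn_sub, Pi.smul_apply, Pi.sub_apply, smul_eq_mul,
      lp.single_apply, Pi.single_apply] at h2
    rw [Finset.sum_range_succ', mul_add]
    simp only [convPow]
    simp only [convPow] at h2
    linarith

end Regular

section Growth

variable {G : Type*} [Group G] {μ : G → ℝ}

/-- If the balls `T ^ m` grow exponentially, the Green function has subexponential mass on them. -/
lemma exists_sum_green_le_of_exp_growth (hμ : IsProbMeasure μ) (hadm : IsAdmissible μ)
    (hsum : ∀ x, Summable fun n => convPow μ n x) {T : Finset G} (hT : T.Nonempty) {L : ℝ}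
    (hL : 0 < L) (hgrowth : ∀ m : ℕ, Real.exp (L * m) ≤ (T ^ m).card) {ε : ℝ} (hε : 0 < ε) :
    ∃ C : ℝ, ∀ n : ℕ, ∑ x ∈ T ^ n, green μ 1 x ≤ C * Real.exp (ε * n) := by
  set δ : lp (fun _ : G => ℝ) 2 := lp.single 2 1 (1 : ℝ) with hδ
  set Q := lazyOp (leftRegular G) μ with hQ
  obtain ⟨A, hA0, hA⟩ := exists_norm_lazyOp_pow_le (leftRegular G) hμ hadm hT (f := δ)
    (by rw [hδ, lp.norm_single (by norm_num)]; simp)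
    (fun m g => by
      rw [hδ, leftRegular_single, norm_averageOp_leftRegular_single _ hT.pow])
  have hdecay : ∀ m k : ℕ, A * m ^ 3 ≤ k → ‖(Q ^ k) δ‖ ≤ 2 * Real.exp (-(L / 2 * m)) := by
    intro m k hk
    refine le_of_sq_le_sq ?_ (by positivity)
    calc ‖(Q ^ k) δ‖ ^ 2 ≤ 4 / ((T ^ m).card : ℝ) := hA m k hk
      _ ≤ 4 / Real.exp (L * m) := by gcongr; exact hgrowth m
      _ = (2 * Real.exp (-(L / 2 * m))) ^ 2 := by
        rw [mul_pow, ← Real.exp_nat_mul, div_eq_mul_inv, ← Real.exp_neg]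
        norm_num
        ring
  have hsummable : ∀ θ : ℝ, 0 < θ → Summable fun k => ‖(Q ^ k) δ‖ ^ θ := fun θ hθ =>
    summable_rpow_of_le_exp (fun k => norm_nonneg _) hA0 (half_pos hL) hdecay hθ
  have hs : Summable fun k => (Q ^ k) δ :=
    Summable.of_norm (by simpa using hsummable 1 one_pos)
  set g := ∑' k, (Q ^ k) δ
  have hQg : Q g = g - δ := by
    have h1 := hs.hasSum.mapL Q
    have h2 := (hasSum_nat_add_iff' 1).2 hs.hasSum
    simp only [Finset.sum_range_one, pow_zero, one_apply_eq_self] at h2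
    refine h1.unique ?_
    simpa only [pow_succ', mul_apply_eq_comp] using h2
  have hPg : markovOp (leftRegular G) μ g = g - (2 : ℝ) • δ := by
    have h1 : (2 : ℝ) • Q g = g + markovOp (leftRegular G) μ g := by
      rw [hQ, lazyOp_apply, smul_inv_smul₀ two_ne_zero]
    rw [hQg, smul_sub, two_smul ℝ g] at h1
    rw [← sub_eq_iff_eq_add'.2 h1]
    abel
  have hg0 : ∀ x, 0 ≤ g x := fun x =>
    (hs.hasSum.mapL (lp.evalCLM (𝕜 := ℝ) (fun _ : G => ℝ) 2 x)).nonneg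
      fun k => lazyOp_leftRegular_pow_nonneg hμ k x
  have hgreen : ∀ x, green μ 1 x ≤ g x := fun x => by
    rw [green_one_eq]
    refine le_of_tendsto' (hsum x).hasSum.tendsto_sum_nat fun N => ?_
    have h1 := two_mul_sum_convPow_le hμ hg0 hPg N x
    have h2 : 0 ≤ ∑ k ∈ Finset.range N, convPow μ k x :=
      Finset.sum_nonneg fun k _ => convPow_nonneg hμ k x
    linarith
  have hlogT : 0 ≤ Real.log T.card :=
    Real.log_nonneg (by exact_mod_cast hT.card_pos)
  set θ := min 1 (ε / (Real.log T.card + 1))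
  have hθ0 : 0 < θ := lt_min one_pos (by positivity)
  have hθ1 : θ ≤ 1 := min_le_left _ _
  have hθε : θ * Real.log T.card ≤ ε := by
    have : θ ≤ ε / (Real.log T.card + 1) := min_le_right _ _
    rw [le_div_iff₀ (by positivity)] at this
    nlinarith
  refine ⟨∑' k, ‖(Q ^ k) δ‖ ^ θ, fun n => ?_⟩
  set B := T ^ n
  have hB : (1 : ℝ) ≤ B.card := by exact_mod_cast hT.pow.card_pos
  set φ := innerSL ℝ (∑ x ∈ B, lp.single (E := fun _ : G => ℝ) 2 x (1 : ℝ)) with hφ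
  have hφ_apply : ∀ f, φ f = ∑ x ∈ B, f x := fun f => by
    simp [hφ, lp.inner_single_left]
  have hφ1 : ∀ k, φ ((Q ^ k) δ) ≤ 1 := fun k => by
    have h := norm_map_lazyOp_pow_le (π := leftRegular G) (f := δ) (c := 1) hμ φ (fun g => by
      rw [hδ, leftRegular_single, hφ_apply]
      simp only [lp.single_apply, Pi.single_apply, Finset.sum_ite_eq']
      split_ifs <;> norm_num) k 1
    rw [map_one] at h
    exact (le_abs_self _).trans h
  have hφ2 : ∀ k, φ ((Q ^ k) δ) ≤ B.card * ‖(Q ^ k) δ‖ := fun k => by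
    have h := real_inner_le_norm (∑ x ∈ B, lp.single (E := fun _ : G => ℝ) 2 x (1 : ℝ))
      ((Q ^ k) δ)
    rw [norm_sum_single_one] at h
    refine h.trans (mul_le_mul_of_nonneg_right ?_ (norm_nonneg _))
    exact Real.sqrt_le_iff.2 ⟨by linarith, by nlinarith⟩
  have hφθ : ∀ k, φ ((Q ^ k) δ) ≤ (B.card : ℝ) ^ θ * ‖(Q ^ k) δ‖ ^ θ := fun k => by
    rw [← Real.mul_rpow (by positivity) (norm_nonneg _)]
    rcases le_total 1 (B.card * ‖(Q ^ k) δ‖) with h | h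
    · exact (hφ1 k).trans (Real.one_le_rpow h hθ0.le)
    · exact (hφ2 k).trans (Real.self_le_rpow_of_le_one (by positivity) h hθ1)
  have hBexp : (B.card : ℝ) ^ θ ≤ Real.exp (ε * n) := by
    have hlog : Real.log B.card ≤ n * Real.log T.card := by
      rw [← Real.log_pow]
      exact Real.log_le_log (by positivity) (by exact_mod_cast Finset.card_pow_le)
    rw [Real.rpow_def_of_pos (by positivity)]
    refine Real.exp_le_exp.2 ?_
    calc Real.log B.card * θ ≤ (n * Real.log T.card) * θ := by gcongr
      _ = θ * Real.log T.card * n := by ring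
      _ ≤ ε * n := by gcongr
  calc ∑ x ∈ B, green μ 1 x ≤ ∑ x ∈ B, g x := Finset.sum_le_sum fun x _ => hgreen x
    _ = φ g := (hφ_apply g).symm
    _ ≤ (B.card : ℝ) ^ θ * ∑' k, ‖(Q ^ k) δ‖ ^ θ :=
      hasSum_le hφθ (hs.hasSum.mapL φ) ((hsummable θ hθ0).hasSum.mul_left _)
    _ ≤ Real.exp (ε * n) * ∑' k, ‖(Q ^ k) δ‖ ^ θ :=
      mul_le_mul_of_nonneg_right hBexp (tsum_nonneg fun k => Real.rpow_nonneg (norm_nonneg _) _)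
    _ = _ := mul_comm _ _

/-- The Green function has subexponential mass on balls. -/
lemma exists_sum_green_le (hμ : IsProbMeasure μ) (hadm : IsAdmissible μ)
    (hsum : ∀ x, Summable fun n => convPow μ n x) {T : Finset G} (hT : T.Nonempty) {ε : ℝ}
    (hε : 0 < ε) :
    ∃ C : ℝ, ∀ᶠ n : ℕ in atTop, ∑ x ∈ T ^ n, green μ 1 x ≤ C * Real.exp (ε * n) := by
  have hpos : ∀ n : ℕ, (1 : ℝ) ≤ (T ^ n).card := fun n => by exact_mod_cast hT.pow.card_pos
  have hsub : Subadditive fun n : ℕ => Real.log (T ^ n).card := fun m n => by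
    have h1 := hpos m
    have h2 := hpos n
    rw [← Real.log_mul (by positivity) (by positivity)]
    refine Real.log_le_log (by linarith [hpos (m + n)]) ?_
    rw [pow_add]
    exact_mod_cast Finset.card_mul_le
  have hnonneg : ∀ n : ℕ, 0 ≤ Real.log (T ^ n).card / n := fun n =>
    div_nonneg (Real.log_nonneg (hpos n)) n.cast_nonneg
  have hbdd : BddBelow (Set.range fun n : ℕ => Real.log (T ^ n).card / n) :=
    ⟨0, by rintro _ ⟨n, rfl⟩; exact hnonneg n⟩
  have hlim := hsub.tendsto_lim hbdd
  rcases (ge_of_tendsto' hlim hnonneg).eq_or_lt with h0 | hL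
  · rw [← h0] at hlim
    refine ⟨green μ 1 1, ?_⟩
    filter_upwards [hlim.eventually_lt_const hε, eventually_gt_atTop 0] with n hn hn0
    have hn0' : (0 : ℝ) < n := by exact_mod_cast hn0
    have hcard : ((T ^ n).card : ℝ) ≤ Real.exp (ε * n) := by
      rw [← Real.log_le_iff_le_exp (by linarith [hpos n])]
      exact ((div_lt_iff₀ hn0').1 hn).le
    calc ∑ x ∈ T ^ n, green μ 1 x ≤ (T ^ n).card • green μ 1 1 :=
          Finset.sum_le_card_nsmul _ _ _ fun x _ => green_one_le hμ hsum x
      _ = green μ 1 1 * (T ^ n).card := by rw [nsmul_eq_mul, mul_comm]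
      _ ≤ _ := mul_le_mul_of_nonneg_left hcard (green_one_nonneg hμ 1)
  · obtain ⟨C, hC⟩ := exists_sum_green_le_of_exp_growth hμ hadm hsum hT hL (fun m => by
      rcases Nat.eq_zero_or_pos m with rfl | hm
      · simp
      · have hm' : (0 : ℝ) < m := by exact_mod_cast hm
        rw [← Real.le_log_iff_exp_le (by linarith [hpos m]), ← le_div_iff₀ hm']
        exact hsub.lim_le_div hbdd hm.ne') hε
    exact ⟨C, Eventually.of_forall hC⟩

lemma mem_pow_wordLength {S : Finset G} (hS : Subgroup.closure (S : Set G) = ⊤) (x : G) :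
    x ∈ (S ∪ S⁻¹) ^ wordLength S x := by
  have hx : x ∈ Subgroup.closure (S : Set G) := hS ▸ Subgroup.mem_top x
  rw [← Subgroup.mem_toSubmonoid, Subgroup.closure_toSubmonoid] at hx
  have hne : {n : ℕ | x ∈ ((S : Set G) ∪ (S : Set G)⁻¹) ^ n}.Nonempty := by
    induction hx using Submonoid.closure_induction with
    | mem y hy => exact ⟨1, by simpa using hy⟩
    | one => exact ⟨0, by simp⟩
    | mul y z _ _ hy hz =>
      obtain ⟨m, hm⟩ := hy
      obtain ⟨n, hn⟩ := hz
      exact ⟨m + n, by rw [Set.mem_ofPred_eq, pow_add]; exact Set.mul_mem_mul hm hn⟩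
  have h := Nat.sInf_mem hne
  rw [← Finset.mem_coe]
  push_cast
  exact h

lemma greenSphereSum_eq_sum {S : Finset G} (hS : Subgroup.closure (S : Set G) = ⊤) (n : ℕ) :
    greenSphereSum S μ 1 n =
      ∑ x ∈ ((S ∪ S⁻¹) ^ n).filter (fun x => wordLength S x = n), green μ 1 x := by
  rw [greenSphereSum, Finset.sum_filter]
  refine tsum_eq_sum fun x hx => if_neg fun h => hx ?_
  rw [← h]
  exact mem_pow_wordLength hS x

lemma frequently_log_greenSphereSum_ge {S : Finset G} (hS : Subgroup.closure (S : Set G) = ⊤)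
    (hμ : IsProbMeasure μ) (hsum : ∀ x, Summable fun n => convPow μ n x) {ε : ℝ} (hε : 0 < ε) :
    ∃ᶠ n : ℕ in atTop, -ε ≤ Real.log (greenSphereSum S μ 1 n) / n := by
  by_contra hcon
  rw [not_frequently] at hcon
  have hnonneg : ∀ n, 0 ≤ greenSphereSum S μ 1 n := fun n => by
    rw [greenSphereSum_eq_sum hS]
    exact Finset.sum_nonneg fun x _ => green_one_nonneg hμ x
  have hH : Summable (greenSphereSum S μ 1) := by
    have hgeom : Summable fun n : ℕ => Real.exp (-ε) ^ n :=
      summable_geometric_of_lt_one (Real.exp_nonneg _) (Real.exp_lt_one_iff.2 (by linarith))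
    refine hgeom.of_norm_bounded_eventually_nat ?_
    filter_upwards [hcon, eventually_gt_atTop 0] with n hn hn0
    have hn0' : (0 : ℝ) < n := by exact_mod_cast hn0
    rw [not_le, div_lt_iff₀ hn0'] at hn
    rw [Real.norm_of_nonneg (hnonneg n), ← Real.exp_nat_mul, mul_comm]
    rcases (hnonneg n).eq_or_lt with h0 | h0
    · rw [← h0]; positivity
    · exact (Real.log_le_iff_le_exp h0).1 hn.le
  refine not_summable_green_one hμ hsum
    (summable_of_sum_le (c := ∑' n, greenSphereSum S μ 1 n) (green_one_nonneg hμ) fun F => ?_)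
  calc ∑ x ∈ F, green μ 1 x
      = ∑ n ∈ F.image (wordLength S), ∑ x ∈ F.filter (fun x => wordLength S x = n), green μ 1 x :=
        (Finset.sum_fiberwise_of_maps_to (fun x hx => Finset.mem_image_of_mem _ hx) _).symm
    _ ≤ ∑ n ∈ F.image (wordLength S), greenSphereSum S μ 1 n := by
        refine Finset.sum_le_sum fun n _ => ?_
        rw [greenSphereSum_eq_sum hS]
        refine Finset.sum_le_sum_of_subset_of_nonneg (fun x hx => ?_)
          fun x _ _ => green_one_nonneg hμ x
        have hxn := (Finset.mem_filter.1 hx).2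
        exact Finset.mem_filter.2 ⟨hxn ▸ mem_pow_wordLength hS x, hxn⟩
    _ ≤ _ := hH.sum_le_tsum _ fun n _ => hnonneg n

lemma eventually_log_greenSphereSum_le {S : Finset G} (hS : Subgroup.closure (S : Set G) = ⊤)
    (hμ : IsProbMeasure μ) (hadm : IsAdmissible μ)
    (hsum : ∀ x, Summable fun n => convPow μ n x) {ε : ℝ} (hε : 0 < ε) :
    ∀ᶠ n : ℕ in atTop, Real.log (greenSphereSum S μ 1 n) / n ≤ ε := by
  rcases (S ∪ S⁻¹).eq_empty_or_nonempty with hemp | hT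
  · filter_upwards [eventually_gt_atTop 0] with n hn
    rw [greenSphereSum_eq_sum hS, hemp, Finset.empty_pow hn.ne']
    simpa using hε.le
  obtain ⟨C, hC⟩ := exists_sum_green_le hμ hadm hsum hT (half_pos hε)
  have hlim : Tendsto (fun n : ℕ => Real.log (max C 1) / n) atTop (nhds 0) :=
    tendsto_const_div_atTop_nhds_zero_nat _
  filter_upwards [hC, hlim.eventually_lt_const (half_pos hε), eventually_gt_atTop 0]
    with n hn hlog hn0
  have hn0' : (0 : ℝ) < n := by exact_mod_cast hn0
  have hle : greenSphereSum S μ 1 n ≤ max C 1 * Real.exp (ε / 2 * n) := by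
    rw [greenSphereSum_eq_sum hS]
    refine (Finset.sum_le_sum_of_subset_of_nonneg (Finset.filter_subset _ _)
      fun x _ _ => green_one_nonneg hμ x).trans (hn.trans ?_)
    gcongr
    exact le_max_left _ _
  have hnonneg : 0 ≤ greenSphereSum S μ 1 n := by
    rw [greenSphereSum_eq_sum hS]
    exact Finset.sum_nonneg fun x _ => green_one_nonneg hμ x
  rcases hnonneg.eq_or_lt with h0 | h0
  · rw [← h0]; simpa using hε.le
  have h := Real.log_le_log h0 hle
  rw [Real.log_mul (by positivity) (by positivity), Real.log_exp] at h
  rw [div_lt_iff₀ hn0'] at hlog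
  rw [div_le_iff₀ hn0']
  linarith

end Growth

/-- Let `Γ` be a finitely generated group and let `μ` be an admissible
probability measure on `Γ` whose random walk is transient at the spectral radius.
Then `ω_Γ(1) = 0`. -/
theorem greenGrowthRate_one_eq_zero {G : Type*} [Group G] (S : Finset G)
    (hS : Subgroup.closure (S : Set G) = ⊤) (μ : G → ℝ)
    (hprob : IsProbMeasure μ) (hadm : IsAdmissible μ)
    (htrans : TransientAtSpectralRadius μ) :
    greenGrowthRate S μ 1 = 0 := by
  have hsum := summable_convPow hprob hadm htrans
  have hup : ∀ ε : ℝ, 0 < ε →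
      ∀ᶠ n : ℕ in atTop, Real.log (greenSphereSum S μ 1 n) / n ≤ ε := fun ε hε =>
    eventually_log_greenSphereSum_le hS hprob hadm hsum hε
  have hlow : ∀ ε : ℝ, 0 < ε →
      ∃ᶠ n : ℕ in atTop, -ε ≤ Real.log (greenSphereSum S μ 1 n) / n := fun ε hε =>
    frequently_log_greenSphereSum_ge hS hprob hsum hε
  refine le_antisymm (le_of_forall_pos_le_add fun ε hε => ?_)
    (le_of_forall_pos_le_add fun ε hε => ?_)
  · rw [zero_add]
    exact limsup_le_of_le (IsCoboundedUnder.of_frequently_ge (hlow 1 one_pos)) (hup ε hε)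
  · rw [← neg_le_iff_add_nonneg]
    exact le_limsup_of_frequently_le (hlow ε hε) ⟨1, hup 1 one_pos⟩

end GreenGrowth
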